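/- Expansion of the SRK one-step approximation applied to a test function (main expansion theorem): Let Y(t)=Y(t_0+h), h>0, be the one-step value of an autonomous s-stage stochastic Runge–Kutta method with starting value Y(t_0), regarded together with its stage values as functions of θ∈ℝ^{κ+1} that are (n+1)-times continuously differentiable near the segment joining 0 and θ(h) and satisfy the stage equations identically in θ, and let f:ℝ^d→ℝ, a, b^1,…,b^m be (n+1)-times continuously differentiable. Then for every n∈ℕ there exists ξ∈(0,1) such that f(Y(t)) = Σ über alle t∈LTS(Δ) with l(t)−1≤n of Σ_{j_1,…,j_{s(t)}=1}^m [γ(t)·Φ_S(t)·F(t)(Y(t_0))]/(l(t)−1)! + R_n(t,t_0), where the Lagrange remainder is R_n(t,t_0) = (1/(n+1)!)·Σ_{ν_1,…,ν_{n+1}∈M̄} Δθ_{ν_1}⋯Δθ_{ν_{n+1}}·∂^{n+1}(f∘Y)/(∂θ_{ν_1}⋯∂θ_{ν_{n+1}}) with the θ-derivatives evaluated at the point ξ·θ(h), and Δθ_ν = θ_ν(h). -/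

import Mathlib

open scoped BigOperators
open Finset MeasureTheory ProbabilityTheory

noncomputable section

namespace SRKPaper

/-- `ℝ^d` with the Euclidean norm. -/
abbrev Evec (d : ℕ) : Type := EuclideanSpace ℝ (Fin d)

/-- The index pairs `(k,ν)` of the SRK method: `det` is `(0,0)`,
`sto k ν` is `(k,ν)` with `k ∈ {1,…,m}`, `ν ∈ M`. -/
inductive SIdx (m : ℕ) (M : Type) : Type where
  | det : SIdx m M
  | sto : Fin m → M → SIdx m M

/-- `M̄ = M ∪ {0}`, with `none` playing the role of the index `0`. -/
abbrev Mbar (M : Type) : Type := Option M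

/-- The real coefficients of an autonomous `s`-stage stochastic Runge–Kutta method. -/
structure SRK (m s : ℕ) (M : Type) : Type where
  α : Fin s → ℝ
  γc : M → SIdx m M → Fin s → ℝ
  A : SIdx m M → Fin s → Fin s → ℝ
  B : M → SIdx m M → Fin m → M → Fin s → Fin s → ℝ

variable {d m s : ℕ} {M : Type}

section SRKdefs
variable [Fintype M]

/-- θ-dependent weights `z^{(k,ν)}`. -/
def SRK.z (c : SRK m s M) (θ : Mbar M → ℝ) : SIdx m M → Fin s → ℝ
  | .det => fun i => c.α i * θ none
  | .sto k ν => fun i => ∑ ι : M, c.γc ι (.sto k ν) i * θ (some ι)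

/-- θ-dependent stage coefficients `Z^{(k,ν),(r,μ)}`; the first index is the
father pair `p = (k,ν)`, the second the son pair. -/
def SRK.Z (c : SRK m s M) (θ : Mbar M → ℝ) (p : SIdx m M) : SIdx m M → Fin s → Fin s → ℝ
  | .det => fun i j => c.A p i j * θ none
  | .sto r μ => fun i j => ∑ ι : M, c.B ι p r μ i j * θ (some ι)

/-- The stage equations of the autonomous SRK method with starting value `y0`. -/
def StageEq (c : SRK m s M) (a : Evec d → Evec d) (b : Fin m → Evec d → Evec d)
    (y0 : Evec d) (θ : Mbar M → ℝ) (H : SIdx m M → Fin s → Evec d) : Prop :=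
  ∀ (p : SIdx m M) (i : Fin s),
    H p i = y0 + (∑ j, c.Z θ p .det i j • a (H .det j))
      + ∑ j, ∑ r, ∑ μ, c.Z θ p (.sto r μ) i j • b r (H (.sto r μ) j)

/-- The one-step value `Y(t)` of the SRK method. -/
def oneStep (c : SRK m s M) (a : Evec d → Evec d) (b : Fin m → Evec d → Evec d)
    (y0 : Evec d) (θ : Mbar M → ℝ) (H : SIdx m M → Fin s → Evec d) : Evec d :=
  y0 + (∑ i, c.z θ .det i • a (H .det i))
    + ∑ i, ∑ k, ∑ ν, c.z θ (.sto k ν) i • b k (H (.sto k ν) i)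

end SRKdefs

/-- A monotonically labelled S-tree with `l+1` nodes: node `0` is the root, the
nonroot nodes are labelled `1,…,l` and are represented by `Fin l` (node `i : Fin l`
has true label `i+1`).  `father i` is the father of node `i+1` (a node label in
`Fin (l+1)`), and `color i` is the colour of node `i+1`: `none` is a deterministic
node `τ`, `some j` a stochastic node `σ_j` with (concrete) variable index `j`. -/
structure STree (l m : ℕ) : Type where
  father : Fin l → Fin (l + 1)
  color : Fin l → Option (Fin m)
  mono : ∀ i : Fin l, (father i).val ≤ i.val

def STree.equivSubtype (l m : ℕ) :
    STree l m ≃ {p : (Fin l → Fin (l+1)) × (Fin l → Option (Fin m)) //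
      ∀ i : Fin l, (p.1 i).val ≤ i.val} where
  toFun t := ⟨(t.father, t.color), t.mono⟩
  invFun p := ⟨p.1.1, p.1.2, p.2⟩
  left_inv t := rfl
  right_inv p := rfl

instance (l m : ℕ) : Fintype (STree l m) := Fintype.ofEquiv _ (STree.equivSubtype l m).symm

/-- The set of sons of the node with label `v`. -/
def STree.child {l m : ℕ} (t : STree l m) (v : Fin (l+1)) : Finset (Fin l) :=
  Finset.univ.filter fun i => t.father i = v

/-- interpretation of a colour by the corresponding coefficient function (`b^0 = a`). -/
def nodeFun (a : Evec d → Evec d) (b : Fin m → Evec d → Evec d) :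
    Option (Fin m) → Evec d → Evec d
  | none => a
  | some j => b j

/-- The elementary differential attached to the subtree rooted at the nonroot node `i`
(fuel-based recursion; the fuel `l` always suffices). -/
def elemFAux (a : Evec d → Evec d) (b : Fin m → Evec d → Evec d) {l : ℕ} (t : STree l m) :
    ℕ → Fin l → Evec d → Evec d
  | 0, _, _ => 0
  | fuel + 1, i, x =>
      iteratedFDeriv ℝ (t.child i.succ).card (nodeFun a b (t.color i)) x
        fun p => elemFAux a b t fuel ((t.child i.succ).orderIsoOfFin rfl p).1 x

def elemF (a : Evec d → Evec d) (b : Fin m → Evec d → Evec d) {l : ℕ} (t : STree l m)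
    (i : Fin l) : Evec d → Evec d := elemFAux a b t l i

/-- The elementary differential `F(t)(x)` of a tree whose root has colour `γ`
(representing the functional `f`). -/
def elemFRoot (f : Evec d → ℝ) (a : Evec d → Evec d) (b : Fin m → Evec d → Evec d)
    {l : ℕ} (t : STree l m) (x : Evec d) : ℝ :=
  iteratedFDeriv ℝ (t.child 0).card f x
    fun p => elemF a b t ((t.child 0).orderIsoOfFin rfl p).1 x

/-- The elementary differential `F(t)(x)` of a tree whose root has colour `rc`
(`none = τ`, `some j = σ_j`). -/
def elemFRootV (a : Evec d → Evec d) (b : Fin m → Evec d → Evec d) (rc : Option (Fin m))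
    {l : ℕ} (t : STree l m) (x : Evec d) : Evec d :=
  iteratedFDeriv ℝ (t.child 0).card (nodeFun a b rc) x
    fun p => elemF a b t ((t.child 0).orderIsoOfFin rfl p).1 x

/-- number of nodes of the subtree rooted at the nonroot node `i` (fuel-based). -/
def sizeAux {l m : ℕ} (t : STree l m) : ℕ → Fin l → ℕ
  | 0, _ => 0
  | fuel + 1, i => 1 + ∑ c ∈ t.child i.succ, sizeAux t fuel c

def STree.size {l m : ℕ} (t : STree l m) (i : Fin l) : ℕ := sizeAux t l i

/-- density of the subtree rooted at the nonroot node `i`. -/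
def densAux {l m : ℕ} (t : STree l m) : ℕ → Fin l → ℕ
  | 0, _ => 1
  | fuel + 1, i => t.size i * ∏ c ∈ t.child i.succ, densAux t fuel c

def STree.densNode {l m : ℕ} (t : STree l m) (i : Fin l) : ℕ := densAux t l i

/-- density `γ(t)` of a tree whose root has colour `γ`. -/
def STree.densDelta {l m : ℕ} (t : STree l m) : ℕ := ∏ c ∈ t.child 0, t.densNode c

/-- density `γ(t)` of a tree (with `l+1` nodes) whose root has colour `τ` or `σ_j`. -/
def STree.densR {l m : ℕ} (t : STree l m) : ℕ := (l+1) * ∏ c ∈ t.child 0, t.densNode c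

/-- number `s(t)` of stochastic nonroot nodes. -/
def STree.scount {l m : ℕ} (t : STree l m) : ℕ :=
  (Finset.univ.filter fun i : Fin l => (t.color i).isSome = true).card

/-- number `d(t)` of deterministic nonroot nodes. -/
def STree.dcount {l m : ℕ} (t : STree l m) : ℕ :=
  (Finset.univ.filter fun i : Fin l => t.color i = none).card

section PhiDefs
variable [Fintype M]

/-- The vector `Ψ^{(p)}` of the subtree rooted at the nonroot node `i`, where `p` is
the index pair of the father of `i` (fuel-based recursion). -/
def PsiAux (c : SRK m s M) (θ : Mbar M → ℝ) {l : ℕ} (t : STree l m) :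
    ℕ → Fin l → SIdx m M → Fin s → ℝ
  | 0, _, _, _ => 1
  | fuel + 1, i, p, q =>
    match t.color i with
    | none => ∑ j, c.Z θ p .det q j * ∏ cc ∈ t.child i.succ, PsiAux c θ t fuel cc .det j
    | some jj => ∑ μ : M, ∑ j, c.Z θ p (.sto jj μ) q j *
        ∏ cc ∈ t.child i.succ, PsiAux c θ t fuel cc (.sto jj μ) j

def PsiN (c : SRK m s M) (θ : Mbar M → ℝ) {l : ℕ} (t : STree l m)
    (i : Fin l) (p : SIdx m M) (q : Fin s) : ℝ := PsiAux c θ t l i p q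

/-- the elementary-weight factor contributed by the subtree rooted at a son of the root. -/
def phiFactor (c : SRK m s M) (θ : Mbar M → ℝ) {l : ℕ} (t : STree l m) (i : Fin l) : ℝ :=
  match t.color i with
  | none => ∑ j, c.z θ .det j * ∏ cc ∈ t.child i.succ, PsiN c θ t cc .det j
  | some jj => ∑ μ : M, ∑ j, c.z θ (.sto jj μ) j *
      ∏ cc ∈ t.child i.succ, PsiN c θ t cc (.sto jj μ) j

/-- The elementary weight `Φ_S(t)` of a `γ`-rooted tree. -/
def PhiS (c : SRK m s M) (θ : Mbar M → ℝ) {l : ℕ} (t : STree l m) : ℝ :=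
  ∏ i ∈ t.child 0, phiFactor c θ t i

/-- `∑_{i₁} Z^{(k,ν)}_{i,i₁} Φ_{i₁}(t)` for a tree with root colour `rc`, the sum over
the pair `(j_r,ν_r)` of the root being shared between the `Z`-factor and `Φ`. -/
def ZPhi (c : SRK m s M) (θ : Mbar M → ℝ) (p : SIdx m M) (i : Fin s)
    (rc : Option (Fin m)) {l : ℕ} (t : STree l m) : ℝ :=
  match rc with
  | none => ∑ i1, c.Z θ p .det i i1 * ∏ cc ∈ t.child 0, PsiN c θ t cc .det i1
  | some jr => ∑ ν : M, ∑ i1, c.Z θ p (.sto jr ν) i i1 *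
      ∏ cc ∈ t.child 0, PsiN c θ t cc (.sto jr ν) i1

/-- `∑_{i₁} z_{i₁} Φ_{i₁}(t)` for a tree with root colour `rc`. -/
def zPhi (c : SRK m s M) (θ : Mbar M → ℝ)
    (rc : Option (Fin m)) {l : ℕ} (t : STree l m) : ℝ :=
  match rc with
  | none => ∑ i1, c.z θ .det i1 * ∏ cc ∈ t.child 0, PsiN c θ t cc .det i1
  | some jr => ∑ ν : M, ∑ i1, c.z θ (.sto jr ν) i1 *
      ∏ cc ∈ t.child 0, PsiN c θ t cc (.sto jr ν) i1

end PhiDefs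

/-- `D^q` with increments `Δ` applied to `g` at the point `θ0`:
`∑_{ν₁,…,ν_q ∈ M̄} Δθ_{ν₁}⋯Δθ_{ν_q} ∂^q g/(∂θ_{ν₁}⋯∂θ_{ν_q})(θ0)`. -/
def Dq {ι : Type} [Fintype ι] [DecidableEq ι] {F : Type}
    [NormedAddCommGroup F] [NormedSpace ℝ F]
    (q : ℕ) (Δ : ι → ℝ) (g : (ι → ℝ) → F) (θ0 : ι → ℝ) : F :=
  ∑ νs : Fin q → ι, (∏ r, Δ (νs r)) •
    iteratedFDeriv ℝ q g θ0 fun r => Pi.single (νs r) 1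

/-- `∑_{ν₁,…,ν_q ∈ M̄} ∂^q g/(∂θ_{ν₁}⋯∂θ_{ν_q})(θ0)`. -/
def DerSum {ι : Type} [Fintype ι] [DecidableEq ι] {F : Type}
    [NormedAddCommGroup F] [NormedSpace ℝ F]
    (q : ℕ) (g : (ι → ℝ) → F) (θ0 : ι → ℝ) : F :=
  ∑ νs : Fin q → ι, iteratedFDeriv ℝ q g θ0 fun r => Pi.single (νs r) 1

/-- the space `C_P^l`: `l` times continuously differentiable with all derivatives up
to order `l` of polynomial growth. -/
def IsCP {d : ℕ} {F : Type} [NormedAddCommGroup F] [NormedSpace ℝ F]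
    (l : ℕ) (g : Evec d → F) : Prop :=
  ContDiff ℝ l g ∧ ∀ i : ℕ, i ≤ l → ∃ K > (0:ℝ), ∃ r : ℕ,
    ∀ x, ‖iteratedFDeriv ℝ i g x‖ ≤ K * (1 + ‖x‖ ^ (2*r))

/-- A labelled tree is special if no node except possibly the root has more than one son. -/
def IsSpecial {q : ℕ} (t : STree q 0) : Prop :=
  ∀ i : Fin q, (t.child i.succ).card ≤ 1

instance {q : ℕ} : DecidablePred (IsSpecial (q := q)) := fun t => by
  unfold IsSpecial; infer_instance

end SRKPaper


namespace SRKPaper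

section Calculus

variable {E F : Type} [NormedAddCommGroup E] [NormedSpace ℝ E]
  [NormedAddCommGroup F] [NormedSpace ℝ F]

/-- The first argument of an iterated derivative may be taken out. -/
theorem iteratedFDeriv_cons_apply (k : ℕ) {F : Type} [NormedAddCommGroup F] [NormedSpace ℝ F]
    {g : E → F} (hg : ContDiff ℝ ((k + 1 : ℕ) : WithTop ℕ∞) g) (x v : E) (w : Fin k → E) :
    iteratedFDeriv ℝ (k + 1) g x (Fin.cons v w : Fin (k + 1) → E) =
      iteratedFDeriv ℝ k (fderiv ℝ g) x w v := by
  induction k generalizing F with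
  | zero =>
    rw [iteratedFDeriv_succ_apply_right]
    simp
  | succ k ih =>
    have hg' : ContDiff ℝ ((k + 1 : ℕ) : WithTop ℕ∞) (fderiv ℝ g) :=
      hg.fderiv_right (by push_cast; rfl)
    have hg'' : ContDiff ℝ (k : WithTop ℕ∞) (fderiv ℝ (fderiv ℝ g)) :=
      hg'.fderiv_right (by push_cast; rfl)
    have hflip : ∀ u p q, iteratedFDeriv ℝ k (fderiv ℝ (fderiv ℝ g)) x u p q =
        iteratedFDeriv ℝ k (fderiv ℝ (fderiv ℝ g)) x u q p := by
      intro u p q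
      have hev : ∀ p q, iteratedFDeriv ℝ k (fderiv ℝ (fderiv ℝ g)) x u p q =
          iteratedFDeriv ℝ k (fun y => fderiv ℝ (fderiv ℝ g) y p q) x u := by
        intro p q
        rw [iteratedFDeriv_clm_apply_const_apply (hg''.clm_apply contDiff_const) le_rfl,
          iteratedFDeriv_clm_apply_const_apply hg'' le_rfl]
      rw [hev, hev]
      congr 2
      funext y
      have hsymm : IsSymmSndFDerivAt ℝ g y := by
        refine hg.contDiffAt.isSymmSndFDerivAt ?_
        simp only [minSmoothness_of_isRCLikeNormedField]
        exact_mod_cast (by omega : 2 ≤ k + 1 + 1)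
      exact hsymm p q
    have hinit : Fin.init (Fin.cons v w : Fin (k + 2) → E) = Fin.cons v (Fin.init w) := by
      funext i
      refine Fin.cases ?_ (fun j => ?_) i <;> simp [Fin.init]
    have hlast : (Fin.cons v w : Fin (k + 2) → E) (Fin.last (k + 1)) = w (Fin.last k) := by
      rw [← Fin.succ_last, Fin.cons_succ]
    rw [iteratedFDeriv_succ_apply_right, hinit, hlast, ih hg' (Fin.init w),
      iteratedFDeriv_succ_apply_right]
    exact hflip _ _ _

/-- The derivatives at `0` of a product with the identity. -/
theorem iteratedDeriv_id_smul_zero (k : ℕ) {G : ℝ → F} (hG : ContDiffAt ℝ k G 0) :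
    iteratedDeriv k (fun u => u • G u) 0 = (k : ℝ) • iteratedDeriv (k - 1) G 0 := by
  induction k generalizing G with
  | zero => simp
  | succ k ih =>
    have hG' : ContDiffAt ℝ k (deriv G) 0 := hG.derivWithin (by push_cast; rfl)
    have hev : deriv (fun u => u • G u) =ᶠ[nhds 0] fun u => G u + u • deriv G u := by
      filter_upwards [hG.eventually (by simp)] with u hu
      have hd := hu.differentiableAt (by simp)
      have := ((hasDerivAt_id u).smul hd.hasDerivAt).deriv
      simp only [id] at this
      rw [add_comm, ← one_smul ℝ (G u)]
      exact this
    have hG'' : ContDiffAt ℝ k (fun u => u • deriv G u) 0 := contDiffAt_id.smul hG'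
    rw [iteratedDeriv_succ', hev.iteratedDeriv_eq, iteratedDeriv_fun_add
      (hG.of_le (by exact_mod_cast Nat.le_succ k)) hG'', ih hG']
    cases k with
    | zero => simp
    | succ k =>
      simp only [Nat.add_sub_cancel]
      rw [← iteratedDeriv_succ']
      push_cast
      module

/-- The Leibniz rule, written as a sum over subsets. -/
theorem iteratedDeriv_clm_apply_eq_sum_powerset {ι : Type} [DecidableEq ι] (S : Finset ι)
    {c : ℝ → E →L[ℝ] F} {v : ℝ → E} {x : ℝ}
    (hc : ContDiffAt ℝ S.card c x) (hv : ContDiffAt ℝ S.card v x) :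
    iteratedDeriv S.card (fun u => c u (v u)) x =
      ∑ A ∈ S.powerset, iteratedDeriv (S \ A).card c x (iteratedDeriv A.card v x) := by
  induction S using Finset.induction_on generalizing c v with
  | empty => simp
  | insert i S hi ih =>
    rw [Finset.card_insert_of_notMem hi] at hc hv ⊢
    have hle : (S.card : WithTop ℕ∞) ≤ ((S.card + 1 : ℕ) : WithTop ℕ∞) := by
      exact_mod_cast Nat.le_succ _
    have hc' : ContDiffAt ℝ S.card (deriv c) x := hc.derivWithin (by push_cast; rfl)
    have hv' : ContDiffAt ℝ S.card (deriv v) x := hv.derivWithin (by push_cast; rfl)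
    have hev : deriv (fun u => c u (v u)) =ᶠ[nhds x]
        fun u => deriv c u (v u) + c u (deriv v u) := by
      filter_upwards [hc.eventually (by simp), hv.eventually (by simp)] with u hcu hvu
      exact ((hcu.differentiableAt (by simp)).hasDerivAt.clm_apply
        (hvu.differentiableAt (by simp)).hasDerivAt).deriv
    rw [iteratedDeriv_succ', hev.iteratedDeriv_eq, iteratedDeriv_fun_add
      (hc'.clm_apply (hv.of_le hle)) ((hc.of_le hle).clm_apply hv'),
      ih hc' (hv.of_le hle), ih (hc.of_le hle) hv', Finset.sum_powerset_insert hi]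
    congr 1
    · refine Finset.sum_congr rfl fun A hA => ?_
      have hiA : i ∉ A := fun h => hi (Finset.mem_powerset.1 hA h)
      rw [Finset.insert_sdiff_of_notMem _ hiA, Finset.card_insert_of_notMem (by simp [hi]),
        iteratedDeriv_succ']
    · refine Finset.sum_congr rfl fun A hA => ?_
      have hiA : i ∉ A := fun h => hi (Finset.mem_powerset.1 hA h)
      rw [Finset.card_insert_of_notMem hiA, iteratedDeriv_succ', Finset.insert_sdiff_insert,
        Finset.sdiff_insert_of_notMem hi]

/-- Taylor's formula with Lagrange remainder along a segment, the remainder being written with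
partial derivatives. -/
theorem exists_taylor_segment {ι : Type} [Fintype ι] [DecidableEq ι] (n : ℕ)
    {g : (ι → ℝ) → ℝ} {U : Set (ι → ℝ)} (hU : IsOpen U) {v : ι → ℝ}
    (hseg : segment ℝ 0 v ⊆ U) (hg : ContDiffOn ℝ ((n + 1 : ℕ) : WithTop ℕ∞) g U) :
    ∃ ξ ∈ Set.Ioo (0 : ℝ) 1, g v =
      (∑ l ∈ Finset.range (n + 1),
        iteratedDeriv l (fun u : ℝ => g (u • v)) 0 / (Nat.factorial l : ℝ)) +
      (1 / (Nat.factorial (n + 1) : ℝ)) * ∑ νs : Fin (n + 1) → ι, (∏ r, v (νs r)) *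
        iteratedFDeriv ℝ (n + 1) g (ξ • v) (fun r => Pi.single (νs r) 1) := by
  set L : ℝ →L[ℝ] (ι → ℝ) := ContinuousLinearMap.toSpanSingleton ℝ v with hL
  have hLa : ∀ u, L u = u • v := fun u => by simp [hL]
  have hmem : ∀ u ∈ Set.Icc (0 : ℝ) 1, L u ∈ U := fun u hu => hseg (by
    rw [segment_eq_image]
    exact ⟨u, hu, by simp [hLa]⟩)
  have hV : IsOpen (L ⁻¹' U) := hU.preimage L.continuous
  have hφ : ContDiffOn ℝ ((n + 1 : ℕ) : WithTop ℕ∞) (g ∘ L) (L ⁻¹' U) :=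
    hg.comp_continuousLinearMap L
  have hφ0 : ContDiffAt ℝ ((n + 1 : ℕ) : WithTop ℕ∞) (g ∘ L) 0 :=
    hφ.contDiffAt (hV.mem_nhds (hmem 0 (by simp)))
  have hIcc : Set.uIcc (0 : ℝ) 1 = Set.Icc 0 1 := Set.uIcc_of_le zero_le_one
  obtain ⟨ξ, hξ, h⟩ := taylor_mean_remainder_lagrange_iteratedDeriv (f := g ∘ L) (x := 1)
    (x₀ := 0) (n := n) zero_ne_one
    (by rw [hIcc]; exact_mod_cast hφ.mono hmem)
  rw [Set.uIoo_of_le zero_le_one] at hξ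
  refine ⟨ξ, hξ, ?_⟩
  have hlhs : (g ∘ L) 1 = g v := by simp [hLa]
  rw [hlhs, sub_eq_iff_eq_add'] at h
  rw [h]
  congr 1
  · rw [taylor_within_apply]
    refine Finset.sum_congr rfl fun l hl => ?_
    have hl' : l ≤ n + 1 := by have := Finset.mem_range.1 hl; omega
    rw [iteratedDerivWithin_eq_iteratedDeriv (hIcc ▸ uniqueDiffOn_Icc zero_lt_one)
      (hφ0.of_le (by exact_mod_cast hl')) (by simp)]
    have : (g ∘ L) = fun u : ℝ => g (u • v) := funext fun u => by simp [hLa]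
    rw [this]
    simp
    field_simp
  · have hξU : L ξ ∈ U := hmem ξ (Set.Ioo_subset_Icc_self hξ)
    have hcomp := L.iteratedFDerivWithin_comp_right hg hU.uniqueDiffOn hV.uniqueDiffOn hξU
      (i := n + 1) le_rfl
    rw [iteratedFDerivWithin_of_isOpen _ hV hξU, iteratedFDerivWithin_of_isOpen _ hU hξU] at hcomp
    have hv : v = ∑ i, v i • (Pi.single i 1 : ι → ℝ) := by
      funext j
      simp [Finset.sum_apply, Pi.single_apply]
    have hexp : iteratedFDeriv ℝ (n + 1) g (ξ • v) (fun _ => v) =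
        ∑ νs : Fin (n + 1) → ι, (∏ r, v (νs r)) *
          iteratedFDeriv ℝ (n + 1) g (ξ • v) (fun r => Pi.single (νs r) 1) := by
      conv_lhs =>
        enter [2]
        rw [hv]
      rw [ContinuousMultilinearMap.map_sum]
      exact Finset.sum_congr rfl fun νs _ => ContinuousMultilinearMap.map_smul_univ _ _ _
    rw [← hexp, iteratedDeriv_eq_iteratedFDeriv, hcomp,
      ContinuousMultilinearMap.compContinuousLinearMap_apply, hLa]
    simp only [hLa, one_smul]
    ring

end Calculus

section TreeValues

variable {N m : ℕ}

theorem STree.mem_child {t : STree N m} {v : Fin (N + 1)} {i : Fin N} :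
    i ∈ t.child v ↔ t.father i = v :=
  Finset.mem_filter_univ _

theorem STree.lt_of_mem_child {t : STree N m} {i c : Fin N} (h : c ∈ t.child i.succ) : i < c := by
  have h1 := t.mono c
  rw [STree.mem_child.1 h] at h1
  rw [Fin.val_succ] at h1
  exact Fin.lt_def.2 h1

theorem sizeAux_eq_sizeAux (t : STree N m) (k k' : ℕ) (i : Fin N) (hk : N ≤ i + k)
    (hk' : N ≤ i + k') : sizeAux t k i = sizeAux t k' i := by
  induction k generalizing k' i with
  | zero => omega
  | succ k ih =>
    cases k' with
    | zero => omega
    | succ k' =>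
      simp only [sizeAux]
      congr 1
      refine Finset.sum_congr rfl fun c hc => ?_
      have := Fin.lt_def.1 (STree.lt_of_mem_child hc)
      exact ih k' c (by omega) (by omega)

theorem STree.size_eq (t : STree N m) (i : Fin N) :
    t.size i = 1 + ∑ c ∈ t.child i.succ, t.size c := by
  have h : t.size i = sizeAux t (N + 1) i := sizeAux_eq_sizeAux t _ _ i (by omega) (by omega)
  rw [h]
  rfl

/-- The sizes of the subtrees rooted at the sons of `r` add up to the number of descendants. -/
theorem STree.sum_size_eq_card (t : STree N m) (S : Finset (Fin N)) (r : Fin (N + 1))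
    (hr : ∀ j ∈ S, r ≠ j.succ)
    (hS : ∀ i, i ∈ S ↔ t.father i = r ∨ ∃ j ∈ S, t.father i = j.succ) :
    ∑ c ∈ t.child r, t.size c = S.card := by
  have h1 : ∑ i ∈ S, t.size i = S.card + ∑ i ∈ S, ∑ c ∈ t.child i.succ, t.size c := by
    rw [Finset.sum_congr rfl fun i _ => t.size_eq i, Finset.sum_add_distrib]
    simp
  have hdisj : Set.PairwiseDisjoint (S : Set (Fin N)) fun i => t.child i.succ := by
    intro i _ j _ hij
    refine Finset.disjoint_left.2 fun c hc hc' => hij ?_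
    rw [STree.mem_child] at hc hc'
    exact Fin.succ_injective _ (hc.symm.trans hc')
  have h2 : S = t.child r ∪ S.biUnion fun i => t.child i.succ := by
    ext i
    simp [hS i, STree.mem_child]
  have hdisj' : Disjoint (t.child r) (S.biUnion fun i => t.child i.succ) := by
    refine Finset.disjoint_left.2 fun c hc hc' => ?_
    obtain ⟨j, hj, hcj⟩ := Finset.mem_biUnion.1 hc'
    rw [STree.mem_child] at hc hcj
    exact hr j hj (hc.symm.trans hcj)
  have h3 : ∑ i ∈ S, t.size i = ∑ c ∈ t.child r, t.size c +
      ∑ i ∈ S, ∑ c ∈ t.child i.succ, t.size c := by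
    conv_lhs => rw [h2]
    rw [Finset.sum_union hdisj', Finset.sum_biUnion hdisj]
  omega

variable {E F : Type} [NormedAddCommGroup E] [NormedSpace ℝ E]
  [NormedAddCommGroup F] [NormedSpace ℝ F]

/-- The derivative of `g` at `x` applied to the vectors attached to a finite set of nodes. -/
def childDeriv (g : E → F) (x : E) (C : Finset (Fin N)) (v : Fin N → E) : F :=
  iteratedFDeriv ℝ C.card g x fun p => v (C.orderIsoOfFin rfl p).1

theorem childDeriv_congr {g : E → F} {x : E} {C C' : Finset (Fin N)} {v v' : Fin N → E}
    (hC : C = C') (hv : ∀ i ∈ C, v i = v' i) : childDeriv g x C v = childDeriv g x C' v' := by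
  subst hC
  unfold childDeriv
  congr 1
  funext p
  exact hv _ (C.orderIsoOfFin rfl p).2

theorem childDeriv_empty {g : E → F} {x : E} {v : Fin N → E} : childDeriv g x ∅ v = g x := by
  unfold childDeriv
  exact iteratedFDeriv_zero_apply _

theorem childDeriv_smul {g : E → F} {x : E} {C : Finset (Fin N)} (r : Fin N → ℝ)
    (v : Fin N → E) :
    childDeriv g x C (fun i => r i • v i) = (∏ i ∈ C, r i) • childDeriv g x C v := by
  unfold childDeriv
  rw [ContinuousMultilinearMap.map_smul_univ]
  congr 1
  rw [← Finset.prod_coe_sort C]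
  exact Equiv.prod_comp (C.orderIsoOfFin rfl).toEquiv fun i : C => r i

theorem childDeriv_insert {g : E → F} {x : E} {C : Finset (Fin N)} {v : Fin N → E} {i : Fin N}
    (hi : ∀ j ∈ C, i < j) (hg : ContDiff ℝ ((C.card + 1 : ℕ) : WithTop ℕ∞) g) :
    childDeriv g x (insert i C) v = childDeriv (fderiv ℝ g) x C v (v i) := by
  have hiC : i ∉ C := fun h => lt_irrefl _ (hi i h)
  have hcard : (insert i C).card = C.card + 1 := Finset.card_insert_of_notMem hiC
  have key : ∀ (k : ℕ) (hk : (insert i C).card = k),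
      childDeriv g x (insert i C) v =
        iteratedFDeriv ℝ k g x fun p => v ((insert i C).orderEmbOfFin hk p) := by
    rintro k rfl
    rfl
  rw [key _ hcard]
  have hemb : (fun p => v ((insert i C).orderEmbOfFin hcard p)) =
      (Fin.cons (v i) fun p => v (C.orderEmbOfFin rfl p) : Fin (C.card + 1) → E) := by
    have hu : (Fin.cons i (C.orderEmbOfFin rfl) : Fin (C.card + 1) → Fin N) =
        (insert i C).orderEmbOfFin hcard := by
      refine Finset.orderEmbOfFin_unique hcard (fun p => ?_) ?_
      · refine Fin.cases ?_ (fun q => ?_) p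
        · simp
        · simp
      · intro p q hpq
        induction q using Fin.cases with
        | zero => exact absurd hpq (Fin.not_lt_zero _)
        | succ q =>
          induction p using Fin.cases with
          | zero => simpa using hi _ (C.orderEmbOfFin_mem rfl q)
          | succ p => simpa using hpq
    rw [← hu]
    funext p
    refine Fin.cases ?_ (fun q => ?_) p <;> simp
  rw [hemb, iteratedFDeriv_cons_apply _ hg]
  rfl

section NodeValues

variable {𝒥 : Type} [Fintype 𝒥] (col : 𝒥 → Option (Fin m)) (W : Option 𝒥 → 𝒥 → ℝ)
  (G : Option (Fin m) → E → E) (x : E)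

/-- The vector contributed by the subtree rooted at the node `i`, including its density and its
elementary weight, when the father of `i` is evaluated at the stage `I` (fuel-based). -/
def nodeValAux (t : STree N m) : ℕ → Fin N → Option 𝒥 → E
  | 0, _, _ => 0
  | fuel + 1, i, I => (t.size i : ℝ) • ∑ J with col J = t.color i,
      W I J • childDeriv (G (col J)) x (t.child i.succ) fun c => nodeValAux t fuel c (some J)

/-- The vector contributed by the subtree rooted at the node `i`. -/
def nodeVal (t : STree N m) (i : Fin N) (I : Option 𝒥) : E := nodeValAux col W G x t N i I

theorem nodeValAux_eq_nodeValAux (t : STree N m) (k k' : ℕ) (i : Fin N) (I : Option 𝒥)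
    (hk : N ≤ i + k) (hk' : N ≤ i + k') :
    nodeValAux col W G x t k i I = nodeValAux col W G x t k' i I := by
  induction k generalizing k' i I with
  | zero => omega
  | succ k ih =>
    cases k' with
    | zero => omega
    | succ k' =>
      simp only [nodeValAux]
      congr 1
      refine Finset.sum_congr rfl fun J _ => ?_
      congr 1
      refine childDeriv_congr rfl fun c hc => ?_
      have := Fin.lt_def.1 (STree.lt_of_mem_child hc)
      exact ih k' c _ (by omega) (by omega)

theorem nodeVal_eq (t : STree N m) (i : Fin N) (I : Option 𝒥) :
    nodeVal col W G x t i I = (t.size i : ℝ) • ∑ J with col J = t.color i,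
      W I J • childDeriv (G (col J)) x (t.child i.succ)
        fun c => nodeVal col W G x t c (some J) := by
  have h : nodeVal col W G x t i I = nodeValAux col W G x t (N + 1) i I :=
    nodeValAux_eq_nodeValAux col W G x t _ _ i I (by omega) (by omega)
  rw [h]
  rfl

/-- Two trees agree below a set of nodes closed under taking sons. -/
def AgreeOn (t t' : STree N m) (S : Finset (Fin N)) : Prop :=
  ∀ i ∈ S, t.color i = t'.color i ∧ t.child i.succ = t'.child i.succ ∧ t.child i.succ ⊆ S

theorem AgreeOn.size_eq {t t' : STree N m} {S : Finset (Fin N)} (h : AgreeOn t t' S)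
    {i : Fin N} (hi : i ∈ S) : t.size i = t'.size i := by
  have aux : ∀ k, ∀ i ∈ S, sizeAux t k i = sizeAux t' k i := by
    intro k
    induction k with
    | zero => intro i _; rfl
    | succ k ih =>
      intro i hi
      simp only [sizeAux]
      rw [← (h i hi).2.1]
      congr 1
      exact Finset.sum_congr rfl fun c hc => ih c ((h i hi).2.2 hc)
  exact aux N i hi

theorem AgreeOn.nodeVal_eq {t t' : STree N m} {S : Finset (Fin N)} (h : AgreeOn t t' S)
    {i : Fin N} (hi : i ∈ S) (I : Option 𝒥) :
    nodeVal col W G x t i I = nodeVal col W G x t' i I := by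
  have aux : ∀ k, ∀ i ∈ S, ∀ I, nodeValAux col W G x t k i I = nodeValAux col W G x t' k i I := by
    intro k
    induction k with
    | zero => intro i _ I; rfl
    | succ k ih =>
      intro i hi I
      simp only [nodeValAux]
      rw [h.size_eq hi, (h i hi).1]
      congr 1
      refine Finset.sum_congr rfl fun J _ => ?_
      congr 1
      exact childDeriv_congr (h i hi).2.1 fun c hc => ih c ((h i hi).2.2 hc) _
  exact aux N i hi I

end NodeValues

end TreeValues

section Decomposition

variable {N m : ℕ}

theorem STree.ext' {t t' : STree N m} (hf : ∀ i, t.father i = t'.father i)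
    (hc : ∀ i, t.color i = t'.color i) : t = t' := by
  cases t
  cases t'
  simp only [STree.mk.injEq]
  exact ⟨funext hf, funext hc⟩

/-- Trees whose nodes in `S` descend from `r` within `S`; all other nodes carry trivial data. -/
def IsTreeOn (S : Finset (Fin N)) (r : Fin (N + 1)) (t : STree N m) : Prop :=
  (∀ i ∈ S, t.father i = r ∨ ∃ j ∈ S, t.father i = j.succ) ∧
    ∀ i ∉ S, t.father i = 0 ∧ t.color i = none

/-- `A` consists of the proper descendants of the node `i₀` within `S`. -/
def IsDescendants (t : STree N m) (i₀ : Fin N) (S A : Finset (Fin N)) : Prop :=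
  ∀ i ∈ S, i ∈ A ↔ t.father i = i₀.succ ∨ ∃ j ∈ A, t.father i = j.succ

theorem STree.lt_of_father_eq_succ {t : STree N m} {i j : Fin N} (h : t.father i = j.succ) :
    j < i :=
  STree.lt_of_mem_child (STree.mem_child.2 h)

theorem exists_isDescendants (t : STree N m) (i₀ : Fin N) (S : Finset (Fin N)) :
    ∃ A ⊆ S, IsDescendants t i₀ S A := by
  induction S using Finset.induction_on_max with
  | empty => exact ⟨∅, subset_rfl, fun i hi => absurd hi (Finset.notMem_empty i)⟩
  | insert x S hx ih =>
    obtain ⟨A, hAS, hA⟩ := ih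
    have hxA : x ∉ A := fun h => lt_irrefl _ (hx x (hAS h))
    by_cases hx' : t.father x = i₀.succ ∨ ∃ j ∈ A, t.father x = j.succ
    · refine ⟨insert x A, Finset.insert_subset_insert x hAS, fun i hi => ?_⟩
      rcases Finset.mem_insert.1 hi with rfl | hiS
      · refine iff_of_true (Finset.mem_insert_self _ _) (hx'.imp_right ?_)
        rintro ⟨j, hj, h⟩
        exact ⟨j, Finset.mem_insert_of_mem hj, h⟩
      · have hne : i ≠ x := (hx i hiS).ne
        rw [Finset.mem_insert, or_iff_right hne, hA i hiS]
        refine or_congr_right ⟨?_, ?_⟩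
        · rintro ⟨j, hj, h⟩
          exact ⟨j, Finset.mem_insert_of_mem hj, h⟩
        · rintro ⟨j, hj, h⟩
          rcases Finset.mem_insert.1 hj with rfl | hj
          · exact absurd (STree.lt_of_father_eq_succ h) (hx i hiS).asymm
          · exact ⟨j, hj, h⟩
    · refine ⟨A, hAS.trans (Finset.subset_insert x S), fun i hi => ?_⟩
      rcases Finset.mem_insert.1 hi with rfl | hiS
      · exact iff_of_false hxA hx'
      · exact hA i hiS

theorem IsDescendants.unique {t : STree N m} {i₀ : Fin N} {S A A' : Finset (Fin N)}
    (hAS : A ⊆ S) (hAS' : A' ⊆ S) (hA : IsDescendants t i₀ S A) (hA' : IsDescendants t i₀ S A') :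
    A = A' := by
  have key : ∀ i : Fin N, i ∈ A ↔ i ∈ A' := by
    intro i
    induction i using WellFoundedLT.induction with
    | ind i ih =>
      by_cases hiS : i ∈ S
      · rw [hA i hiS, hA' i hiS]
        refine or_congr_right (exists_congr fun j => and_congr_left fun h => ?_)
        exact ih j (STree.lt_of_father_eq_succ h)
      · exact iff_of_false (fun h => hiS (hAS h)) fun h => hiS (hAS' h)
  exact Finset.ext key

/-- The part of a tree carried by `A`. -/
def STree.restrict (t : STree N m) (A : Finset (Fin N)) : STree N m where
  father i := if i ∈ A then t.father i else 0
  color i := if i ∈ A then t.color i else none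
  mono i := by
    split_ifs
    · exact t.mono i
    · simp

/-- The tree in which `i₀` is a son of `r` with colour `k`, the nodes of `A` are arranged as in
`t₁`, and all others as in `t₂`. -/
def STree.glue (i₀ : Fin N) (r : Fin (N + 1)) (hr : r.val ≤ i₀.val) (A : Finset (Fin N))
    (k : Option (Fin m)) (t₁ t₂ : STree N m) : STree N m where
  father i := if i = i₀ then r else if i ∈ A then t₁.father i else t₂.father i
  color i := if i = i₀ then k else if i ∈ A then t₁.color i else t₂.color i
  mono i := by
    split_ifs with h
    · exact h ▸ hr
    · exact t₁.mono i
    · exact t₂.mono i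

section Glue

variable {i₀ : Fin N} {r : Fin (N + 1)} (hr : r.val ≤ i₀.val) {S A : Finset (Fin N)}
  {k : Option (Fin m)} {t₁ t₂ : STree N m}

theorem STree.glue_self : (STree.glue i₀ r hr A k t₁ t₂).father i₀ = r ∧
    (STree.glue i₀ r hr A k t₁ t₂).color i₀ = k := by
  simp [STree.glue]

include hr in
theorem ne_succ_of_le {j : Fin N} (hj : i₀ ≤ j) : r ≠ j.succ := by
  rintro rfl
  have := Fin.le_def.1 hj
  simp only [Fin.val_succ] at hr
  omega

variable (hS : ∀ j ∈ S, i₀ < j) (hAS : A ⊆ S)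

include hS hAS in
theorem STree.glue_of_mem {i : Fin N} (hi : i ∈ A) :
    (STree.glue i₀ r hr A k t₁ t₂).father i = t₁.father i ∧
    (STree.glue i₀ r hr A k t₁ t₂).color i = t₁.color i := by
  have : i ≠ i₀ := (hS i (hAS hi)).ne'
  simp [STree.glue, this, hi]

theorem STree.glue_of_notMem {i : Fin N} (hi₀ : i ≠ i₀) (hi : i ∉ A) :
    (STree.glue i₀ r hr A k t₁ t₂).father i = t₂.father i ∧
    (STree.glue i₀ r hr A k t₁ t₂).color i = t₂.color i := by
  simp [STree.glue, hi, hi₀]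

variable (h₁ : IsTreeOn A i₀.succ t₁) (h₂ : IsTreeOn (S \ A) r t₂)

include hS hAS h₁ h₂

theorem isTreeOn_glue : IsTreeOn (insert i₀ S) r (STree.glue i₀ r hr A k t₁ t₂) := by
  refine ⟨fun i hi => ?_, fun i hi => ?_⟩
  · rcases Finset.mem_insert.1 hi with rfl | hiS
    · exact Or.inl (STree.glue_self hr).1
    · by_cases hiA : i ∈ A
      · rw [(STree.glue_of_mem hr hS hAS hiA).1]
        rcases h₁.1 i hiA with h | ⟨j, hj, h⟩
        · exact Or.inr ⟨i₀, Finset.mem_insert_self _ _, h⟩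
        · exact Or.inr ⟨j, Finset.mem_insert_of_mem (hAS hj), h⟩
      · rw [(STree.glue_of_notMem hr (hS i hiS).ne' hiA).1]
        refine (h₂.1 i (Finset.mem_sdiff.2 ⟨hiS, hiA⟩)).imp_right ?_
        rintro ⟨j, hj, h⟩
        exact ⟨j, Finset.mem_insert_of_mem (Finset.mem_sdiff.1 hj).1, h⟩
  · rw [Finset.mem_insert, not_or] at hi
    have := STree.glue_of_notMem (k := k) (t₁ := t₁) (t₂ := t₂) hr hi.1 fun h => hi.2 (hAS h)
    rw [this.1, this.2]
    exact h₂.2 i fun h => hi.2 (Finset.mem_sdiff.1 h).1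

theorem mem_iff_glue (i : Fin N) : i ∈ A ↔
    (STree.glue i₀ r hr A k t₁ t₂).father i = i₀.succ ∨
      ∃ j ∈ A, (STree.glue i₀ r hr A k t₁ t₂).father i = j.succ := by
  by_cases hiA : i ∈ A
  · rw [(STree.glue_of_mem hr hS hAS hiA).1]
    exact iff_of_true hiA (h₁.1 i hiA)
  · refine iff_of_false hiA ?_
    have hrne : ¬(r = i₀.succ ∨ ∃ j ∈ A, r = j.succ) := by
      rintro (h | ⟨j, hj, h⟩)
      · exact ne_succ_of_le hr le_rfl h
      · exact ne_succ_of_le hr (hS j (hAS hj)).le h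
    by_cases hi₀ : i = i₀
    · rw [hi₀, (STree.glue_self hr).1]
      exact hrne
    · rw [(STree.glue_of_notMem hr hi₀ hiA).1]
      by_cases hiS : i ∈ S
      · rcases h₂.1 i (Finset.mem_sdiff.2 ⟨hiS, hiA⟩) with h | ⟨j, hj, h⟩
        · rw [h]
          exact hrne
        · rw [h]
          rw [Finset.mem_sdiff] at hj
          rintro (h' | ⟨j', hj', h'⟩)
          · exact (hS j hj.1).ne' (Fin.succ_injective _ h')
          · exact hj.2 (Fin.succ_injective _ h' ▸ hj')
      · rw [(h₂.2 i fun h => hiS (Finset.mem_sdiff.1 h).1).1]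
        rintro (h | ⟨j, _, h⟩)
        · exact (Fin.succ_ne_zero _ h.symm)
        · exact (Fin.succ_ne_zero _ h.symm)

theorem isDescendants_glue : IsDescendants (STree.glue i₀ r hr A k t₁ t₂) i₀ S A :=
  fun i _ => mem_iff_glue hr hS hAS h₁ h₂ i

theorem child_glue_of_mem {v : Fin N} (hv : v ∈ insert i₀ A) :
    (STree.glue i₀ r hr A k t₁ t₂).child v.succ = t₁.child v.succ := by
  ext i
  rw [STree.mem_child, STree.mem_child]
  by_cases hiA : i ∈ A
  · rw [(STree.glue_of_mem hr hS hAS hiA).1]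
  · refine iff_of_false (fun h => hiA ?_) fun h => ?_
    · refine (mem_iff_glue (k := k) hr hS hAS h₁ h₂ i).2 ?_
      rcases Finset.mem_insert.1 hv with rfl | hv
      · exact Or.inl h
      · exact Or.inr ⟨v, hv, h⟩
    · rw [(h₁.2 i hiA).1] at h
      exact Fin.succ_ne_zero _ h.symm

omit hS hAS h₁ h₂ in
theorem IsTreeOn.child_subset {A : Finset (Fin N)} {r : Fin (N + 1)} {t₁ : STree N m}
    (h₁ : IsTreeOn A r t₁) {v : Fin N} : t₁.child v.succ ⊆ A := by
  intro i hi
  by_contra hiA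
  rw [STree.mem_child, (h₁.2 i hiA).1] at hi
  exact Fin.succ_ne_zero _ hi.symm

theorem agreeOn_glue_left : AgreeOn (STree.glue i₀ r hr A k t₁ t₂) t₁ A := fun i hi => by
  have h := child_glue_of_mem (k := k) hr hS hAS h₁ h₂ (Finset.mem_insert_of_mem hi)
  exact ⟨(STree.glue_of_mem hr hS hAS hi).2, h, h ▸ h₁.child_subset⟩

theorem agreeOn_glue_right : AgreeOn (STree.glue i₀ r hr A k t₁ t₂) t₂ (S \ A) := fun v hv => by
  have hv' := Finset.mem_sdiff.1 hv
  have h : (STree.glue i₀ r hr A k t₁ t₂).child v.succ = t₂.child v.succ := by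
    ext i
    rw [STree.mem_child, STree.mem_child]
    have hr' : r ≠ v.succ := ne_succ_of_le hr (hS v hv'.1).le
    by_cases hi₀ : i = i₀
    · rw [hi₀, (STree.glue_self hr).1]
      refine iff_of_false hr' fun h => ?_
      exact absurd (STree.lt_of_father_eq_succ h) (hS v hv'.1).asymm
    · by_cases hiA : i ∈ A
      · rw [(STree.glue_of_mem hr hS hAS hiA).1]
        refine iff_of_false (fun h => ?_) fun h => ?_
        · rcases h₁.1 i hiA with h' | ⟨j, hj, h'⟩
          · exact (hS v hv'.1).ne' (Fin.succ_injective _ (h.symm.trans h'))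
          · exact hv'.2 (Fin.succ_injective _ (h.symm.trans h') ▸ hj)
        · rw [(h₂.2 i fun h => (Finset.mem_sdiff.1 h).2 hiA).1] at h
          exact Fin.succ_ne_zero _ h.symm
      · rw [(STree.glue_of_notMem hr hi₀ hiA).1]
  exact ⟨(STree.glue_of_notMem hr (hS v hv'.1).ne' hv'.2).2, h, h ▸ h₂.child_subset⟩

omit h₂ in
theorem child_glue_root_inter :
    (STree.glue i₀ r hr A k t₁ t₂).child r ∩ insert i₀ S =
      insert i₀ (t₂.child r ∩ (S \ A)) := by
  ext i
  rw [Finset.mem_inter, Finset.mem_insert, Finset.mem_insert, Finset.mem_inter, Finset.mem_sdiff,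
    STree.mem_child, STree.mem_child]
  by_cases hi₀ : i = i₀
  · simp [hi₀, (STree.glue_self hr).1]
  · by_cases hiA : i ∈ A
    · rw [(STree.glue_of_mem hr hS hAS hiA).1]
      have : t₁.father i ≠ r := by
        rcases h₁.1 i hiA with h | ⟨j, hj, h⟩
        · rw [h]
          exact (ne_succ_of_le hr le_rfl).symm
        · rw [h]
          exact (ne_succ_of_le hr (hS j (hAS hj)).le).symm
      simp [this, hi₀, hiA]
    · rw [(STree.glue_of_notMem hr hi₀ hiA).1]
      simp [hi₀, hiA]

theorem size_glue : (STree.glue i₀ r hr A k t₁ t₂).size i₀ = A.card + 1 := by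
  rw [STree.size_eq, STree.sum_size_eq_card _ A i₀.succ _ (mem_iff_glue hr hS hAS h₁ h₂)]
  · omega
  · intro j hj h
    exact (hS j (hAS hj)).ne (Fin.succ_injective _ h)

omit h₂ in
theorem restrict_glue_left : (STree.glue i₀ r hr A k t₁ t₂).restrict A = t₁ := by
  refine STree.ext' (fun i => ?_) fun i => ?_
  all_goals
    by_cases hiA : i ∈ A
    · simp [STree.restrict, hiA, STree.glue_of_mem hr hS hAS hiA]
    · simp [STree.restrict, hiA, h₁.2 i hiA]

omit hAS h₁ in
theorem restrict_glue_right : (STree.glue i₀ r hr A k t₁ t₂).restrict (S \ A) = t₂ := by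
  refine STree.ext' (fun i => ?_) fun i => ?_
  all_goals
    by_cases hiA : i ∈ S \ A
    · have hi := Finset.mem_sdiff.1 hiA
      simp only [STree.restrict, hiA, if_true]
      simp [STree.glue_of_notMem hr (hS i hi.1).ne' hi.2]
    · simp only [STree.restrict, hiA, if_false]
      simp [h₂.2 i hiA]

end Glue

section Restrict

variable {i₀ : Fin N} {r : Fin (N + 1)} (hr : r.val ≤ i₀.val) {S A : Finset (Fin N)}
  {t : STree N m} (hS : ∀ j ∈ S, i₀ < j) (hAS : A ⊆ S)
  (ht : IsTreeOn (insert i₀ S) r t) (hA : IsDescendants t i₀ S A)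

include hAS hA in
theorem isTreeOn_restrict_left : IsTreeOn A i₀.succ (t.restrict A) := by
  refine ⟨fun i hi => ?_, fun i hi => by simp [STree.restrict, hi]⟩
  simpa only [STree.restrict, hi, if_true] using (hA i (hAS hi)).1 hi

include ht hA in
theorem isTreeOn_restrict_right : IsTreeOn (S \ A) r (t.restrict (S \ A)) := by
  refine ⟨fun i hi => ?_, fun i hi => by simp only [STree.restrict, hi, if_false, and_self]⟩
  simp only [STree.restrict, hi, if_true]
  rw [Finset.mem_sdiff] at hi
  refine (ht.1 i (Finset.mem_insert_of_mem hi.1)).imp_right ?_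
  rintro ⟨j, hj, h⟩
  refine ⟨j, ?_, h⟩
  have hn := mt (hA i hi.1).2 hi.2
  rw [not_or] at hn
  rcases Finset.mem_insert.1 hj with rfl | hj
  · exact absurd h hn.1
  · exact Finset.mem_sdiff.2 ⟨hj, fun hjA => hn.2 ⟨j, hjA, h⟩⟩

include hS ht in
theorem glue_restrict :
    STree.glue i₀ r hr A (t.color i₀) (t.restrict A) (t.restrict (S \ A)) = t := by
  have hroot : t.father i₀ = r := by
    rcases ht.1 i₀ (Finset.mem_insert_self _ _) with h | ⟨j, hj, h⟩
    · exact h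
    · refine absurd (STree.lt_of_father_eq_succ h) (not_lt.2 ?_)
      rcases Finset.mem_insert.1 hj with rfl | hj
      · exact le_rfl
      · exact (hS j hj).le
  refine STree.ext' (fun i => ?_) fun i => ?_
  all_goals
    by_cases hi₀ : i = i₀
    · simp [hi₀, STree.glue, hroot]
    · by_cases hiA : i ∈ A
      · simp [STree.glue, STree.restrict, hi₀, hiA]
      · by_cases hiS : i ∈ S
        · simp [STree.glue, STree.restrict, hi₀, hiA, hiS]
        · simp [STree.glue, STree.restrict, hi₀, hiA, hiS,
            ht.2 i (by simp [hi₀, hiS])]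

end Restrict

open Classical in
/-- The finite set of trees on `S` with root `r`. -/
def treesOn (m : ℕ) (S : Finset (Fin N)) (r : Fin (N + 1)) : Finset (STree N m) :=
  Finset.univ.filter (IsTreeOn S r)

theorem mem_treesOn {S : Finset (Fin N)} {r : Fin (N + 1)} {t : STree N m} :
    t ∈ treesOn m S r ↔ IsTreeOn S r t := by
  simp [treesOn]

/-- A sum over trees, split according to the subtree of the smallest node. -/
theorem sum_treesOn_insert {X : Type} [AddCommMonoid X] {i₀ : Fin N} {r : Fin (N + 1)}
    (hr : r.val ≤ i₀.val) {S : Finset (Fin N)} (hS : ∀ j ∈ S, i₀ < j) (Q : STree N m → X) :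
    ∑ t ∈ treesOn m (insert i₀ S) r, Q t =
      ∑ A ∈ S.powerset, ∑ k : Option (Fin m), ∑ t₁ ∈ treesOn m A i₀.succ,
        ∑ t₂ ∈ treesOn m (S \ A) r, Q (STree.glue i₀ r hr A k t₁ t₂) := by
  classical
  simp_rw [← Finset.sum_product']
  rw [Finset.sum_sigma']
  symm
  refine Finset.sum_bij
    (fun p _ => STree.glue i₀ r hr p.1 p.2.1 p.2.2.1 p.2.2.2) ?_ ?_ ?_ ?_
  · rintro ⟨A, k, t₁, t₂⟩ hp
    simp only [Finset.mem_sigma, Finset.mem_powerset, Finset.mem_product, mem_treesOn] at hp ⊢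
    exact isTreeOn_glue hr hS hp.1 hp.2.2.1 hp.2.2.2
  · rintro ⟨A, k, t₁, t₂⟩ hp ⟨A', k', t₁', t₂'⟩ hp' h
    simp only [Finset.mem_sigma, Finset.mem_powerset, Finset.mem_product, mem_treesOn] at hp hp' h
    obtain rfl : A = A' := by
      have h1 := isDescendants_glue (k := k) hr hS hp.1 hp.2.2.1 hp.2.2.2
      have h2 := isDescendants_glue (k := k') hr hS hp'.1 hp'.2.2.1 hp'.2.2.2
      rw [← h] at h2
      exact h1.unique hp.1 hp'.1 h2
    have e1 := restrict_glue_left (k := k) (t₂ := t₂) hr hS hp.1 hp.2.2.1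
    have e1' := restrict_glue_left (k := k') (t₂ := t₂') hr hS hp'.1 hp'.2.2.1
    have e2 := restrict_glue_right (k := k) (t₁ := t₁) hr hS hp.2.2.2
    have e2' := restrict_glue_right (k := k') (t₁ := t₁') hr hS hp'.2.2.2
    have e3 := (STree.glue_self (A := A) (k := k) (t₁ := t₁) (t₂ := t₂) hr).2
    have e3' := (STree.glue_self (A := A) (k := k') (t₁ := t₁') (t₂ := t₂') hr).2
    rw [← h] at e1' e2' e3'
    obtain rfl : k = k' := e3.symm.trans e3'
    obtain rfl : t₁ = t₁' := e1.symm.trans e1'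
    obtain rfl : t₂ = t₂' := e2.symm.trans e2'
    rfl
  · intro t ht
    rw [mem_treesOn] at ht
    obtain ⟨A, hAS, hA⟩ := exists_isDescendants t i₀ S
    refine ⟨⟨A, t.color i₀, t.restrict A, t.restrict (S \ A)⟩, ?_, glue_restrict hr hS ht⟩
    simp only [Finset.mem_sigma, Finset.mem_powerset, Finset.mem_product, mem_treesOn]
    exact ⟨hAS, Finset.mem_univ _, isTreeOn_restrict_left hAS hA, isTreeOn_restrict_right ht hA⟩
  · intro p _
    rfl

end Decomposition

section Expansion

variable {N m n : ℕ} {E : Type} [NormedAddCommGroup E] [NormedSpace ℝ E]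
  {𝒥 : Type} [Fintype 𝒥] (col : 𝒥 → Option (Fin m)) (W : Option 𝒥 → 𝒥 → ℝ)
  (G : Option (Fin m) → E → E) (x : E)

theorem childDeriv_glue {F : Type} [NormedAddCommGroup F] [NormedSpace ℝ F]
    {i₀ : Fin N} {r : Fin (N + 1)} (hr : r.val ≤ i₀.val) {S A : Finset (Fin N)}
    (hS : ∀ j ∈ S, i₀ < j) (hAS : A ⊆ S) {k : Option (Fin m)} {t₁ t₂ : STree N m}
    (h₁ : IsTreeOn A i₀.succ t₁) (h₂ : IsTreeOn (S \ A) r t₂) {g : E → F}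
    (hg : ContDiff ℝ ((S.card + 1 : ℕ) : WithTop ℕ∞) g) (I : Option 𝒥) :
    childDeriv g x ((STree.glue i₀ r hr A k t₁ t₂).child r ∩ insert i₀ S)
      (fun i => nodeVal col W G x (STree.glue i₀ r hr A k t₁ t₂) i I) =
    childDeriv (fderiv ℝ g) x (t₂.child r ∩ (S \ A)) (fun i => nodeVal col W G x t₂ i I)
      ((A.card + 1 : ℝ) • ∑ J with col J = k, W I J •
        childDeriv (G (col J)) x (t₁.child i₀.succ ∩ A)
          fun i => nodeVal col W G x t₁ i (some J)) := by
  have hsub : t₂.child r ∩ (S \ A) ⊆ S := Finset.inter_subset_right.trans Finset.sdiff_subset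
  rw [child_glue_root_inter hr hS hAS h₁, childDeriv_insert (fun j hj => hS j (hsub hj))
    (hg.of_le (by exact_mod_cast Nat.succ_le_succ (Finset.card_le_card hsub)))]
  rw [childDeriv_congr rfl fun i hi => (agreeOn_glue_right hr hS hAS h₁ h₂).nodeVal_eq col W G x
      (Finset.mem_of_mem_inter_right hi) I]
  congr 1
  · rw [nodeVal_eq, size_glue hr hS hAS h₁ h₂, (STree.glue_self hr).2]
    push_cast
    congr 1
    refine Finset.sum_congr rfl fun J _ => ?_
    congr 1
    refine childDeriv_congr ?_ fun i hi => ?_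
    · rw [child_glue_of_mem hr hS hAS h₁ h₂ (Finset.mem_insert_self _ _),
        Finset.inter_eq_left.2 h₁.child_subset]
    · rw [child_glue_of_mem hr hS hAS h₁ h₂ (Finset.mem_insert_self _ _)] at hi
      exact (agreeOn_glue_left hr hS hAS h₁ h₂).nodeVal_eq col W G x (h₁.child_subset hi) _

/-- The derivatives at `0` of a function composed with a stage are sums over trees. -/
theorem sum_treesOn_childDeriv (hG : ∀ k, ContDiff ℝ n (G k)) {h : Option 𝒥 → ℝ → E}
    (hh : ∀ I, ContDiffAt ℝ n (h I) 0)
    (hst : ∀ I, ∀ᶠ u in nhds 0, h I u = x + u • ∑ J, W I J • G (col J) (h (some J) u))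
    (q : ℕ) (hq : q ≤ n) {F : Type} [NormedAddCommGroup F] [NormedSpace ℝ F] {g : E → F}
    (hg : ContDiff ℝ q g) (S : Finset (Fin N)) (hS : S.card = q) (r : Fin (N + 1))
    (hr : ∀ i ∈ S, r.val ≤ i.val) (I : Option 𝒥) :
    ∑ t ∈ treesOn m S r, childDeriv g x (t.child r ∩ S) (fun i => nodeVal col W G x t i I) =
      iteratedDeriv q (fun u => g (h I u)) 0 := by
  induction q using Nat.strong_induction_on generalizing F S r I with
  | _ q ih =>
    have hh0 : ∀ I, h I 0 = x := fun I => by simpa using (hst I).self_of_nhds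
    rcases S.eq_empty_or_nonempty with rfl | hne
    · obtain rfl : q = 0 := by simpa using hS.symm
      have hone : treesOn m (∅ : Finset (Fin N)) r = {⟨fun _ => 0, fun _ => none, by simp⟩} := by
        ext t
        rw [mem_treesOn, Finset.mem_singleton]
        constructor
        · intro ht
          exact STree.ext' (fun i => (ht.2 i (by simp)).1) fun i => (ht.2 i (by simp)).2
        · rintro rfl
          exact ⟨by simp, by simp⟩
      rw [hone, Finset.sum_singleton, Finset.inter_empty, childDeriv_empty, iteratedDeriv_zero, hh0]
    · set i₀ := S.min' hne
      have hi₀ : i₀ ∈ S := S.min'_mem hne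
      set T := S.erase i₀
      have hST : S = insert i₀ T := (Finset.insert_erase hi₀).symm
      have hT : ∀ j ∈ T, i₀ < j := fun j hj =>
        lt_of_le_of_ne (S.min'_le j (Finset.mem_of_mem_erase hj)) (Finset.ne_of_mem_erase hj).symm
      obtain ⟨p, rfl⟩ : ∃ p, q = p + 1 := ⟨q - 1, by have := hne.card_pos; omega⟩
      have hTp : T.card = p := by rw [Finset.card_erase_of_mem hi₀, hS]; rfl
      have hr₀ := hr i₀ hi₀
      have hpn : (p : WithTop ℕ∞) ≤ n := by exact_mod_cast (by omega : p ≤ n)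
      have hpn' : ((p + 1 : ℕ) : WithTop ℕ∞) ≤ n := by exact_mod_cast hq
      have hg' : ContDiff ℝ p (fderiv ℝ g) := hg.fderiv_right (by push_cast; rfl)
      have hcomp : ∀ {k : ℕ} {F' : Type} [NormedAddCommGroup F'] [NormedSpace ℝ F'] {g' : E → F'},
          k ≤ n → ContDiff ℝ k g' → ∀ I, ContDiffAt ℝ k (fun u => g' (h I u)) 0 := by
        intro k F' _ _ g' hk hg' I
        exact hg'.contDiffAt.comp 0 ((hh I).of_le (by exact_mod_cast hk))
      have hev : deriv (fun u => g (h I u)) =ᶠ[nhds 0]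
          fun u => fderiv ℝ g (h I u) (deriv (h I) u) := by
        filter_upwards [((hh I).of_le hpn').eventually (by simp)] with u hu
        have h1 : HasFDerivAt g (fderiv ℝ g (h I u)) (h I u) :=
          (hg.differentiable (by simp) _).hasFDerivAt
        exact (h1.comp_hasDerivAt u (hu.differentiableAt (by simp)).hasDerivAt).deriv
      have hstage : ∀ k ≤ p, iteratedDeriv k (deriv (h I)) 0 = (k + 1 : ℝ) • ∑ J, W I J •
          iteratedDeriv k (fun u => G (col J) (h (some J) u)) 0 := by
        intro k hk
        have hGk : ∀ J, ContDiffAt ℝ ((k + 1 : ℕ) : WithTop ℕ∞)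
            (fun u => W I J • G (col J) (h (some J) u)) 0 := fun J =>
          contDiffAt_const.smul (hcomp (by omega)
            ((hG (col J)).of_le (by exact_mod_cast (by omega : k + 1 ≤ n))) (some J))
        have hGk' : ∀ J, ContDiffAt ℝ (k : WithTop ℕ∞) (fun u => G (col J) (h (some J) u)) 0 :=
          fun J => hcomp (by omega)
            ((hG (col J)).of_le (by exact_mod_cast (by omega : k ≤ n))) (some J)
        rw [← iteratedDeriv_succ', Filter.EventuallyEq.iteratedDeriv_eq _ (hst I),
          iteratedDeriv_const_add (Nat.succ_pos k),
          iteratedDeriv_id_smul_zero (k + 1) (ContDiffAt.sum fun J _ => hGk J)]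
        push_cast
        rw [iteratedDeriv_fun_sum
          fun J _ => (hGk J).of_le (by exact_mod_cast Nat.le_succ k)]
        congr 1
        refine Finset.sum_congr rfl fun J _ => ?_
        exact iteratedDeriv_fun_const_smul (hGk' J) (W I J)
      rw [iteratedDeriv_succ', hev.iteratedDeriv_eq, ← hTp,
        iteratedDeriv_clm_apply_eq_sum_powerset T (hTp ▸ hcomp (by omega) hg' I)
          (hTp ▸ ((hh I).of_le hpn').derivWithin (by push_cast; rfl)), hST,
        sum_treesOn_insert hr₀ hT]
      refine Finset.sum_congr rfl fun A hA => ?_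
      have hAT := Finset.mem_powerset.1 hA
      have hAc : A.card ≤ p := hTp ▸ Finset.card_le_card hAT
      have hBc : (T \ A).card ≤ p := hTp ▸ Finset.card_le_card Finset.sdiff_subset
      rw [hstage _ hAc, ← ih _ (by omega) (by omega)
        (hg'.of_le (by exact_mod_cast hBc)) (T \ A) rfl r
        (fun i hi => hr₀.trans (hT i (Finset.mem_sdiff.1 hi).1).le) I]
      have hsum : ∀ J, iteratedDeriv A.card (fun u => G (col J) (h (some J) u)) 0 =
          ∑ t ∈ treesOn m A i₀.succ, childDeriv (G (col J)) x (t.child i₀.succ ∩ A)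
            fun i => nodeVal col W G x t i (some J) := by
        intro J
        refine (ih _ (by omega) (by omega) ((hG (col J)).of_le
          (by exact_mod_cast (by omega : A.card ≤ n))) A rfl i₀.succ (fun i hi => ?_) (some J)).symm
        exact hT i (hAT hi)
      simp_rw [hsum]
      have hfib : ∑ J, W I J • ∑ t ∈ treesOn m A i₀.succ,
            childDeriv (G (col J)) x (t.child i₀.succ ∩ A)
              (fun i => nodeVal col W G x t i (some J)) =
          ∑ k, ∑ t ∈ treesOn m A i₀.succ, ∑ J with col J = k, W I J •
            childDeriv (G (col J)) x (t.child i₀.succ ∩ A)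
              (fun i => nodeVal col W G x t i (some J)) := by
        rw [← Finset.sum_fiberwise (s := Finset.univ) (g := col)]
        refine Finset.sum_congr rfl fun k _ => ?_
        rw [Finset.sum_comm]
        exact Finset.sum_congr rfl fun J _ => Finset.smul_sum
      rw [hfib, Finset.smul_sum, map_sum]
      refine Finset.sum_congr rfl fun k _ => ?_
      rw [Finset.smul_sum, map_sum]
      refine Finset.sum_congr rfl fun t₁ ht₁ => ?_
      rw [_root_.sum_apply]
      refine Finset.sum_congr rfl fun t₂ ht₂ => ?_
      exact childDeriv_glue col W G x hr₀ hT hAT (mem_treesOn.1 ht₁) (mem_treesOn.1 ht₂)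
        (hTp ▸ hg) I

theorem treesOn_univ_zero : treesOn m (Finset.univ : Finset (Fin N)) 0 = Finset.univ := by
  ext t
  simp only [mem_treesOn, Finset.mem_univ, iff_true]
  refine ⟨fun i _ => ?_, by simp⟩
  rcases Fin.eq_zero_or_eq_succ (t.father i) with h | ⟨j, h⟩
  · exact Or.inl h
  · exact Or.inr ⟨j, Finset.mem_univ _, h⟩

end Expansion

section Method

variable {d m s : ℕ} {M : Type} [Fintype M]

/-- The index pair `(0,0)` together with the index pairs `(k,ν)`. -/
def SIdx.equivOption (m : ℕ) (M : Type) : Option (Fin m × M) ≃ SIdx m M where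
  toFun o := o.elim .det fun p => .sto p.1 p.2
  invFun
    | .det => none
    | .sto k ν => some (k, ν)
  left_inv o := by cases o <;> rfl
  right_inv p := by cases p <;> rfl

instance : Fintype (SIdx m M) := Fintype.ofEquiv _ (SIdx.equivOption m M)

theorem sum_sIdx {X : Type} [AddCommMonoid X] (φ : SIdx m M → X) :
    ∑ p, φ p = φ .det + ∑ k, ∑ ν, φ (.sto k ν) := by
  rw [← (SIdx.equivOption m M).sum_comp φ, Fintype.sum_option, Fintype.sum_prod_type]
  rfl

/-- The colour of the nodes evaluated at a stage with a given index pair. -/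
def SIdx.color : SIdx m M → Option (Fin m)
  | .det => none
  | .sto k _ => some k

/-- The coefficients of the stages (`some`) and of the one-step value (`none`). -/
def SRK.row (c : SRK m s M) (θ : Mbar M → ℝ) :
    Option (SIdx m M × Fin s) → SIdx m M × Fin s → ℝ
  | none, J => c.z θ J.1 J.2
  | some I, J => c.Z θ I.1 J.1 I.2 J.2

end Method

section Method

variable {d m s N : ℕ} {M : Type} [Fintype M]

theorem densAux_eq_densAux (t : STree N m) (k k' : ℕ) (i : Fin N) (hk : N ≤ i + k)
    (hk' : N ≤ i + k') : densAux t k i = densAux t k' i := by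
  induction k generalizing k' i with
  | zero => omega
  | succ k ih =>
    cases k' with
    | zero => omega
    | succ k' =>
      simp only [densAux]
      congr 1
      refine Finset.prod_congr rfl fun c hc => ?_
      have := Fin.lt_def.1 (STree.lt_of_mem_child hc)
      exact ih k' c (by omega) (by omega)

theorem STree.densNode_eq (t : STree N m) (i : Fin N) :
    t.densNode i = t.size i * ∏ c ∈ t.child i.succ, t.densNode c := by
  have h : t.densNode i = densAux t (N + 1) i := densAux_eq_densAux t _ _ i (by omega) (by omega)
  rw [h]
  rfl

variable (c : SRK m s M) (θ : Mbar M → ℝ)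
  (a : Evec d → Evec d) (b : Fin m → Evec d → Evec d) (y : Evec d)

theorem elemFAux_succ (t : STree N m) (k : ℕ) (i : Fin N) :
    elemFAux a b t (k + 1) i y =
      childDeriv (nodeFun a b (t.color i)) y (t.child i.succ) fun j => elemFAux a b t k j y :=
  rfl

theorem elemFAux_eq_elemFAux (t : STree N m) (k k' : ℕ) (i : Fin N) (hk : N ≤ i + k)
    (hk' : N ≤ i + k') : elemFAux a b t k i y = elemFAux a b t k' i y := by
  induction k generalizing k' i with
  | zero => omega
  | succ k ih =>
    cases k' with
    | zero => omega
    | succ k' =>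
      rw [elemFAux_succ, elemFAux_succ]
      refine childDeriv_congr rfl fun j hj => ?_
      have := Fin.lt_def.1 (STree.lt_of_mem_child hj)
      exact ih k' j (by omega) (by omega)

theorem elemF_eq (t : STree N m) (i : Fin N) :
    elemF a b t i y =
      childDeriv (nodeFun a b (t.color i)) y (t.child i.succ) fun j => elemF a b t j y := by
  have h : elemF a b t i y = elemFAux a b t (N + 1) i y :=
    elemFAux_eq_elemFAux a b y t _ _ i (by omega) (by omega)
  rw [h]
  rfl

theorem sum_color_eq_none (φ : SIdx m M × Fin s → ℝ) :
    ∑ J with J.1.color = none, φ J = ∑ j, φ (.det, j) := by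
  rw [Finset.sum_filter, Fintype.sum_prod_type, sum_sIdx]
  simp [SIdx.color]

theorem sum_color_eq_some (φ : SIdx m M × Fin s → ℝ) (k : Fin m) :
    ∑ J with J.1.color = some k, φ J = ∑ μ, ∑ j, φ (.sto k μ, j) := by
  rw [Finset.sum_filter, Fintype.sum_prod_type, sum_sIdx]
  simp only [SIdx.color, reduceCtorEq, if_false, Finset.sum_const_zero, zero_add, Option.some.injEq]
  rw [Finset.sum_eq_single k (fun k' _ hk' => by simp [hk']) (by simp)]
  simp

theorem PsiAux_succ (t : STree N m) (k : ℕ) (i : Fin N) (I : SIdx m M × Fin s) :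
    PsiAux c θ t (k + 1) i I.1 I.2 = ∑ J with J.1.color = t.color i,
      c.row θ (some I) J * ∏ j ∈ t.child i.succ, PsiAux c θ t k j J.1 J.2 := by
  simp only [PsiAux]
  cases h : t.color i with
  | none => rw [sum_color_eq_none]; rfl
  | some k => rw [sum_color_eq_some]; rfl

theorem phiFactor_eq (t : STree N m) (i : Fin N) :
    phiFactor c θ t i = ∑ J with J.1.color = t.color i,
      c.row θ none J * ∏ j ∈ t.child i.succ, PsiN c θ t j J.1 J.2 := by
  unfold phiFactor
  cases h : t.color i with
  | none => rw [sum_color_eq_none]; rfl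
  | some k => rw [sum_color_eq_some]; rfl

theorem sum_smul_childDeriv {𝒥 : Type} [Fintype 𝒥] (col : 𝒥 → Option (Fin m))
    (k : Option (Fin m)) (w : 𝒥 → ℝ) (G : Option (Fin m) → Evec d → Evec d)
    (C : Finset (Fin N)) (D : Fin N → ℝ) (P : Fin N → 𝒥 → ℝ) (v : Fin N → Evec d) :
    ∑ J with col J = k, w J • childDeriv (G (col J)) y C (fun i => (D i * P i J) • v i) =
      ((∏ i ∈ C, D i) * ∑ J with col J = k, w J * ∏ i ∈ C, P i J) • childDeriv (G k) y C v := by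
  rw [Finset.mul_sum, Finset.sum_smul]
  refine Finset.sum_congr rfl fun J hJ => ?_
  rw [(Finset.mem_filter.1 hJ).2, childDeriv_smul, smul_smul, Finset.prod_mul_distrib]
  congr 1
  ring

theorem nodeValAux_some (t : STree N m) (k : ℕ) (i : Fin N) (I : SIdx m M × Fin s) :
    nodeValAux (fun J => J.1.color) (c.row θ) (nodeFun a b) y t k i (some I) =
      ((densAux t k i : ℝ) * PsiAux c θ t k i I.1 I.2) • elemFAux a b t k i y := by
  induction k generalizing i I with
  | zero => simp [nodeValAux, elemFAux]
  | succ k ih =>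
    simp only [nodeValAux, ih]
    rw [sum_smul_childDeriv y (fun J : SIdx m M × Fin s => J.1.color)
        (P := fun j J => PsiAux c θ t k j J.1 J.2),
      elemFAux_succ, PsiAux_succ, densAux, smul_smul]
    push_cast
    rw [mul_assoc]

theorem nodeVal_none (t : STree N m) (i : Fin N) :
    nodeVal (fun J => J.1.color) (c.row θ) (nodeFun a b) y t i none =
      ((t.densNode i : ℝ) * phiFactor c θ t i) • elemF a b t i y := by
  have h : ∀ j (J : SIdx m M × Fin s),
      nodeVal (fun J => J.1.color) (c.row θ) (nodeFun a b) y t j (some J) =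
        ((t.densNode j : ℝ) * PsiN c θ t j J.1 J.2) • elemF a b t j y :=
    fun j J => nodeValAux_some c θ a b y t N j J
  rw [nodeVal_eq]
  simp only [h]
  rw [sum_smul_childDeriv y (fun J : SIdx m M × Fin s => J.1.color)
      (P := fun j J => PsiN c θ t j J.1 J.2),
    elemF_eq, phiFactor_eq, STree.densNode_eq, smul_smul]
  push_cast
  rw [mul_assoc]

theorem childDeriv_nodeVal_none (f : Evec d → ℝ) (t : STree N m) :
    childDeriv f y (t.child 0)
        (fun i => nodeVal (fun J => J.1.color) (c.row θ) (nodeFun a b) y t i none) =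
      (t.densDelta : ℝ) * PhiS c θ t * elemFRoot f a b t y := by
  simp only [nodeVal_none]
  rw [childDeriv_smul, Finset.prod_mul_distrib, STree.densDelta, Nat.cast_prod]
  rfl

theorem SRK.row_smul (u : ℝ) (I : Option (SIdx m M × Fin s)) (J : SIdx m M × Fin s) :
    c.row (u • θ) I J = u * c.row θ I J := by
  obtain ⟨p, j⟩ := J
  cases I <;> cases p <;>
    simp [SRK.row, SRK.z, SRK.Z, Finset.mul_sum, mul_left_comm]

/-- The value of the stage `I` (`some`) or of the one-step value (`none`) given the stages. -/
def SRK.value (y : Evec d) (H : SIdx m M → Fin s → Evec d) :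
    Option (SIdx m M × Fin s) → Evec d
  | none => oneStep c a b y θ H
  | some I => H I.1 I.2

theorem sum_row_smul (I : Option (SIdx m M × Fin s)) (H : SIdx m M → Fin s → Evec d) :
    ∑ J, c.row θ I J • nodeFun a b J.1.color (H J.1 J.2) =
      (∑ j, c.row θ I (.det, j) • a (H .det j)) +
        ∑ j, ∑ k, ∑ ν, c.row θ I (.sto k ν, j) • b k (H (.sto k ν) j) := by
  rw [Fintype.sum_prod_type_right]
  simp only [sum_sIdx, Finset.sum_add_distrib]
  rfl

theorem oneStep_eq (H : SIdx m M → Fin s → Evec d) :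
    oneStep c a b y θ H = y + ∑ J, c.row θ none J • nodeFun a b J.1.color (H J.1 J.2) := by
  rw [sum_row_smul, ← add_assoc]
  rfl

theorem SRK.value_eq {H : SIdx m M → Fin s → Evec d} (hH : StageEq c a b y θ H)
    (I : Option (SIdx m M × Fin s)) :
    c.value θ a b y H I = y + ∑ J, c.row θ I J • nodeFun a b J.1.color (H J.1 J.2) := by
  cases I with
  | none => exact oneStep_eq c θ a b y H
  | some I =>
    rw [sum_row_smul, ← add_assoc]
    exact hH I.1 I.2

theorem contDiff_row {n : WithTop ℕ∞} (I : Option (SIdx m M × Fin s)) (J : SIdx m M × Fin s) :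
    ContDiff ℝ n fun θ => c.row θ I J := by
  obtain ⟨p, j⟩ := J
  cases I <;> cases p <;> simp only [SRK.row, SRK.z, SRK.Z] <;> fun_prop

theorem contDiff_nodeFun {n : WithTop ℕ∞} (ha : ContDiff ℝ n a) (hb : ∀ k, ContDiff ℝ n (b k))
    (k : Option (Fin m)) : ContDiff ℝ n (nodeFun a b k) := by
  cases k with
  | none => exact ha
  | some k => exact hb k

theorem contDiffOn_value {n : WithTop ℕ∞} (ha : ContDiff ℝ n a) (hb : ∀ k, ContDiff ℝ n (b k))
    {H : (Mbar M → ℝ) → SIdx m M → Fin s → Evec d} {U : Set (Mbar M → ℝ)}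
    (hH : ∀ p i, ContDiffOn ℝ n (fun θ => H θ p i) U) (I : Option (SIdx m M × Fin s)) :
    ContDiffOn ℝ n (fun θ => c.value θ a b y (H θ) I) U := by
  cases I with
  | none =>
    simp only [SRK.value, oneStep_eq]
    exact contDiffOn_const.add (ContDiffOn.sum fun J _ => (contDiff_row c none J).contDiffOn.smul
      ((contDiff_nodeFun a b ha hb _).comp_contDiffOn (hH J.1 J.2)))
  | some I => exact hH I.1 I.2

/-- The derivatives along a ray of a function of the one-step value are sums over trees. -/
theorem sum_tree_eq_iteratedDeriv {n : ℕ} {f : Evec d → ℝ} (hf : ContDiff ℝ n f)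
    (ha : ContDiff ℝ n a) (hb : ∀ k, ContDiff ℝ n (b k))
    {H : (Mbar M → ℝ) → SIdx m M → Fin s → Evec d} {U : Set (Mbar M → ℝ)} (hU : IsOpen U)
    (h0 : 0 ∈ U) (hH : ∀ p i, ContDiffOn ℝ n (fun θ => H θ p i) U)
    (hstage : ∀ θ ∈ U, StageEq c a b y θ (H θ)) (hN : N ≤ n) :
    ∑ t : STree N m, (t.densDelta : ℝ) * PhiS c θ t * elemFRoot f a b t y =
      iteratedDeriv N (fun u : ℝ => f (oneStep c a b y (u • θ) (H (u • θ)))) 0 := by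
  have hray : ContDiff ℝ n fun u : ℝ => u • θ := contDiff_id.smul contDiff_const
  have hU0 : U ∈ nhds ((0 : ℝ) • θ) := by simpa using hU.mem_nhds h0
  have key := sum_treesOn_childDeriv (N := N) (n := n) (fun J : SIdx m M × Fin s => J.1.color)
    (c.row θ) (nodeFun a b) y (contDiff_nodeFun a b ha hb)
    (h := fun I u => c.value (u • θ) a b y (H (u • θ)) I)
    (fun I => ContDiffAt.comp (g := fun θ => c.value θ a b y (H θ) I) (0 : ℝ)
      ((contDiffOn_value c a b y ha hb hH I).contDiffAt hU0) hray.contDiffAt)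
    (fun I => by
      filter_upwards [hray.continuous.continuousAt.preimage_mem_nhds hU0] with u hu
      rw [SRK.value_eq c _ a b y (hstage _ hu) I, Finset.smul_sum]
      simp only [SRK.row_smul, smul_smul]
      rfl)
    N hN (hf.of_le (by exact_mod_cast hN)) Finset.univ (Finset.card_fin N) 0 (by simp) none
  rw [treesOn_univ_zero] at key
  simp only [Finset.inter_univ, childDeriv_nodeVal_none] at key
  exact key

end Method

end SRKPaper

namespace SRKPaper

/-- Expansion of the SRK one-step approximation applied to a test
function, with Lagrange remainder. -/
theorem srk_expansion_of_functional
    (d m s n : ℕ) (M : Type) [Fintype M] [DecidableEq M]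
    (c : SRK m s M)
    (f : Evec d → ℝ) (a : Evec d → Evec d) (b : Fin m → Evec d → Evec d)
    (hf : ContDiff ℝ (n+1) f) (ha : ContDiff ℝ (n+1) a) (hb : ∀ k, ContDiff ℝ (n+1) (b k))
    (y0 : Evec d) (θv : Mbar M → ℝ)
    (H : (Mbar M → ℝ) → SIdx m M → Fin s → Evec d)
    (U : Set (Mbar M → ℝ)) (hU : IsOpen U) (hseg : segment ℝ 0 θv ⊆ U)
    (hHsmooth : ∀ (p : SIdx m M) (i : Fin s), ContDiffOn ℝ (n+1) (fun θ => H θ p i) U)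
    (hstage : ∀ θ ∈ U, StageEq c a b y0 θ (H θ)) :
    ∃ ξ ∈ Set.Ioo (0:ℝ) 1,
      f (oneStep c a b y0 θv (H θv)) =
        (∑ l ∈ Finset.range (n+1), ∑ t : STree l m,
          (t.densDelta : ℝ) * PhiS c θv t * elemFRoot f a b t y0 / (Nat.factorial l : ℝ))
        + (1 / (Nat.factorial (n+1) : ℝ)) *
            ∑ νs : Fin (n+1) → Mbar M, (∏ r, θv (νs r)) *
              iteratedFDeriv ℝ (n+1) (fun θ => f (oneStep c a b y0 θ (H θ))) (ξ • θv)
                (fun r => Pi.single (νs r) 1) := by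
  have h0 : (0 : Mbar M → ℝ) ∈ U := hseg (left_mem_segment ℝ _ _)
  have hle : (n : WithTop ℕ∞) ≤ n + 1 := le_self_add
  obtain ⟨ξ, hξ, h⟩ := exists_taylor_segment n hU hseg
    (g := fun θ => f (oneStep c a b y0 θ (H θ)))
    (by
      push_cast
      exact hf.comp_contDiffOn (contDiffOn_value c a b y0 ha hb hHsmooth none))
  refine ⟨ξ, hξ, h.trans ?_⟩
  congr 1
  refine Finset.sum_congr rfl fun l hl => ?_
  rw [← Finset.sum_div, sum_tree_eq_iteratedDeriv c θv a b y0 (hf.of_le hle) (ha.of_le hle)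
    (fun k => (hb k).of_le hle) hU h0 (fun p i => (hHsmooth p i).of_le hle) hstage
    (Nat.lt_succ_iff.1 (Finset.mem_range.1 hl))]

end SRKPaper
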